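/- Let Z ~ N(0, σ²) with σ > 0, independent of a real random variable X, and set Y = X + Z. If the conditional law of X given Y = y is N(μ(y), σ_X²) for P_Y-almost every y, with σ_X² > 0 not depending on y and σ_X² < σ², then X is Gaussian with variance σ²σ_X²/(σ² − σ_X²). -/

import Mathlib

open MeasureTheory ProbabilityTheory

/-- Joint law of `(X + Z, X)`. -/
lemma aux_joint {Ω : Type*} [MeasureSpace Ω] [IsProbabilityMeasure (ℙ : Measure Ω)]
    (X Z : Ω → ℝ) (hX : Measurable X) (hZ : Measurable Z)
    (s : NNReal) (hs : s ≠ 0)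
    (hZlaw : Measure.map Z ℙ = gaussianReal 0 s)
    (hIndep : IndepFun X Z ℙ) (f : ℝ × ℝ → ENNReal) (hf : Measurable f) :
    ∫⁻ ω, f (X ω + Z ω, X ω) ∂ℙ
      = ∫⁻ y, ∫⁻ x, gaussianPDF x s y * f (y, x) ∂(Measure.map X ℙ) := by
  have hP : IsProbabilityMeasure (Measure.map X ℙ) := Measure.isProbabilityMeasure_map hX.aemeasurable
  have h1 := hIndep.map_prod_eq_prod_map_map hX.aemeasurable hZ.aemeasurable
  have h2 : ∫⁻ ω, f (X ω + Z ω, X ω) ∂ℙ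
      = ∫⁻ p, f (p.1 + p.2, p.1) ∂(Measure.map (fun ω => (X ω, Z ω)) ℙ) := by
    rw [lintegral_map (by fun_prop) (by fun_prop)]
  rw [h2, h1, hZlaw, lintegral_prod _ (by fun_prop)]
  have h3 : ∀ x : ℝ, ∫⁻ z, f (x + z, x) ∂(gaussianReal 0 s)
      = ∫⁻ y, gaussianPDF x s y * f (y, x) := by
    intro x
    have h4 : gaussianReal x s = (gaussianReal 0 s).map (x + ·) := by
      rw [gaussianReal_map_const_add, zero_add]
    have h5 : ∫⁻ y, f (y, x) ∂(gaussianReal x s) = ∫⁻ z, f (x + z, x) ∂(gaussianReal 0 s) := by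
      rw [h4, lintegral_map (by fun_prop) (by fun_prop)]
    rw [← h5, gaussianReal_of_var_ne_zero _ hs,
      lintegral_withDensity_eq_lintegral_mul _ (measurable_gaussianPDF _ _) (by fun_prop)]
    rfl
  simp only [h3]
  rw [lintegral_lintegral_swap]
  fun_prop

lemma aux_pdf_le (x y : ℝ) (s : NNReal) :
    gaussianPDF x s y ≤ ENNReal.ofReal (√(2 * Real.pi * s))⁻¹ := by
  rw [gaussianPDF]
  apply ENNReal.ofReal_le_ofReal
  rw [gaussianPDFReal]
  refine mul_le_of_le_one_right (by positivity) ?_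
  rw [Real.exp_le_one_iff]
  have : 0 ≤ (y - x) ^ 2 / (2 * (s : ℝ)) := by positivity
  rw [neg_div]
  linarith

lemma aux_algebra (s v : NNReal) (hv : 0 < v) (hlt : v < s) (m y : ℝ) :
    ∃ (μ₀ K : ℝ), 0 < K ∧ ∀ x, gaussianPDFReal m v x
      = K * gaussianPDFReal μ₀ (s * v / (s - v)) x * gaussianPDFReal x s y := by
  have hs : 0 < s := hv.trans hlt
  have hd : 0 < s - v := tsub_pos_of_lt hlt
  have hv' : (0:ℝ) < v := hv
  have hs' : (0:ℝ) < s := hs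
  have hd' : (0:ℝ) < (s:ℝ) - v := sub_pos.2 (by exact_mod_cast hlt)
  have hw : (0:ℝ) < ((s * v / (s - v) : NNReal) : ℝ) := by
    have : 0 < s * v / (s - v) := by positivity
    exact_mod_cast this
  have hwe : ((s * v / (s - v) : NNReal) : ℝ) = s * v / ((s:ℝ) - v) := by
    rw [NNReal.coe_div, NNReal.coe_mul, NNReal.coe_sub hlt.le]
  set w := (s * v / (s - v) : NNReal)
  set μ₀ : ℝ := (s * m - v * y) / (s - v) with hμ
  refine ⟨μ₀, (√(2 * Real.pi * v))⁻¹ * √(2 * Real.pi * w) * √(2 * Real.pi * s) *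
    Real.exp (-m ^ 2 / (2 * v) + y ^ 2 / (2 * s) + μ₀ ^ 2 / (2 * w)), by positivity, fun x => ?_⟩
  have hexp : Real.exp (-(x - m) ^ 2 / (2 * v)) =
      Real.exp (-m ^ 2 / (2 * v) + y ^ 2 / (2 * s) + μ₀ ^ 2 / (2 * w)) *
      Real.exp (-(x - μ₀) ^ 2 / (2 * w)) * Real.exp (-(y - x) ^ 2 / (2 * s)) := by
    rw [← Real.exp_add, ← Real.exp_add]
    congr 1
    rw [hwe, hμ]
    field_simp
    ring
  have h1 : √(2 * Real.pi * w) ≠ 0 := by positivity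
  have h2 : √(2 * Real.pi * s) ≠ 0 := by positivity
  simp only [gaussianPDFReal]
  rw [hexp]
  field_simp


/-- Lemma 13: let `Z ~ N(0, σ²)` be independent of `X` and `Y = X + Z`. If the conditional
law of `X` given `Y = y` is `N(μ(y), σ_X²)` for `P_Y`-a.e. `y`, with `0 < σ_X² < σ²` not
depending on `y`, then `X` is Gaussian with variance `σ²σ_X²/(σ² − σ_X²)`. -/
theorem gaussian_of_gaussian_posterior
    {Ω : Type*} [MeasureSpace Ω] [IsProbabilityMeasure (ℙ : Measure Ω)]
    [StandardBorelSpace Ω] [Nonempty Ω]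
    (X Z : Ω → ℝ) (hX : Measurable X) (hZ : Measurable Z)
    (σ σX : NNReal) (hσ : 0 < σ) (hσX : 0 < σX) (hlt : σX ^ 2 < σ ^ 2)
    (hZlaw : Measure.map Z ℙ = gaussianReal 0 (σ ^ 2))
    (hIndep : IndepFun X Z ℙ)
    (m : ℝ → ℝ)
    (hcond : ∀ᵐ y ∂(Measure.map (fun ω => X ω + Z ω) ℙ),
      condDistrib X (fun ω => X ω + Z ω) ℙ y = gaussianReal (m y) (σX ^ 2)) :
    ∃ μ₀ : ℝ, Measure.map X ℙ = gaussianReal μ₀ (σ ^ 2 * σX ^ 2 / (σ ^ 2 - σX ^ 2)) := by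
  have hs : σ ^ 2 ≠ 0 := by positivity
  have hv : 0 < σX ^ 2 := by positivity
  generalize σ ^ 2 = s at *
  generalize σX ^ 2 = v at *
  have hP : IsProbabilityMeasure (Measure.map X ℙ) := Measure.isProbabilityMeasure_map hX.aemeasurable
  have hJ := aux_joint X Z hX hZ s hs hZlaw hIndep
  generalize hPdef : Measure.map X ℙ = P at *
  have hYm : Measurable (fun ω => X ω + Z ω) := hX.add hZ
  have hPY : IsProbabilityMeasure (Measure.map (fun ω => X ω + Z ω) ℙ) :=
    Measure.isProbabilityMeasure_map hYm.aemeasurable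
  have hphi : Measurable (fun q : ℝ × ℝ => gaussianPDF q.2 s q.1) := by fun_prop
  let p : ℝ → ENNReal := fun y => ∫⁻ x, gaussianPDF x s y ∂P
  have hpm : Measurable p := hphi.lintegral_prod_right'
  have hptop : ∀ y, p y ≠ ⊤ := by
    intro y
    have : p y ≤ ∫⁻ x, ENNReal.ofReal (√(2 * Real.pi * s))⁻¹ ∂P :=
      lintegral_mono fun x => aux_pdf_le x y s
    rw [lintegral_const, measure_univ, mul_one] at this
    exact ne_top_of_le_ne_top ENNReal.ofReal_ne_top this
  have hp0 : ∀ y, p y ≠ 0 := by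
    intro y h
    rw [lintegral_eq_zero_iff (by fun_prop)] at h
    obtain ⟨x, hx⟩ := h.exists
    exact (gaussianPDF_pos x hs y).ne' hx
  have hgm : Measurable (Function.uncurry fun y x => gaussianPDF x s y / p y) :=
    hphi.div (hpm.comp measurable_fst)
  let η : Kernel ℝ ℝ := Kernel.withDensity (Kernel.const ℝ P) (fun y x => gaussianPDF x s y / p y)
  have hη : ∀ y, η y = P.withDensity (fun x => gaussianPDF x s y / p y) := fun y => by
    rw [Kernel.withDensity_apply _ hgm, Kernel.const_apply]
  have hpmul : ∀ (y : ℝ) (f : ℝ → ENNReal), Measurable f →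
      p y * ∫⁻ x, f x ∂(η y) = ∫⁻ x, gaussianPDF x s y * f x ∂P := by
    intro y f hf
    rw [hη, lintegral_withDensity_eq_lintegral_mul _ (by fun_prop) hf,
      ← lintegral_const_mul _ (by fun_prop)]
    refine lintegral_congr fun x => ?_
    simp only [Pi.mul_apply]
    rw [← mul_assoc, ENNReal.mul_div_cancel (hp0 y) (hptop y)]
  have hmk : IsMarkovKernel η := by
    refine ⟨fun y => ⟨?_⟩⟩
    have h := hpmul y (fun _ => 1) measurable_const
    simp only [lintegral_one, mul_one] at h
    change p y * _ = p y at h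
    calc η y Set.univ = (p y)⁻¹ * (p y * η y Set.univ) := by
          rw [← mul_assoc, ENNReal.inv_mul_cancel (hp0 y) (hptop y), one_mul]
      _ = 1 := by rw [h, ENNReal.inv_mul_cancel (hp0 y) (hptop y)]
  have hYlaw : Measure.map (fun ω => X ω + Z ω) ℙ = volume.withDensity p := by
    refine Measure.ext_of_lintegral _ fun f hf => ?_
    rw [lintegral_map hf hYm, lintegral_withDensity_eq_lintegral_mul _ hpm hf,
      hJ (fun q => f q.1) (by fun_prop)]
    refine lintegral_congr fun y => ?_
    change ∫⁻ x, gaussianPDF x s y * f y ∂P = _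
    rw [lintegral_mul_const _ (by fun_prop)]
    rfl
  have hjoint : Measure.map (fun ω => (X ω + Z ω, X ω)) ℙ
      = Measure.map (fun ω => X ω + Z ω) ℙ ⊗ₘ η := by
    refine Measure.ext_of_lintegral _ fun f hf => ?_
    rw [lintegral_map hf (by fun_prop), hJ f hf, Measure.lintegral_compProd hf, hYlaw,
      lintegral_withDensity_eq_lintegral_mul _ hpm hf.lintegral_kernel_prod_right']
    refine lintegral_congr fun y => ?_
    rw [Pi.mul_apply, hpmul y (fun x => f (y, x)) (by fun_prop)]
  have hae := condDistrib_ae_eq_of_measure_eq_compProd (fun ω => X ω + Z ω) hX.aemeasurable hjoint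
  obtain ⟨y, hy1, hy2⟩ := (hcond.and hae).exists
  have hy : P.withDensity (fun x => gaussianPDF x s y / p y) = gaussianReal (m y) v := by
    rw [← hη, ← hy2, hy1]
  obtain ⟨μ₀, K, hK, hKx⟩ := aux_algebra s v hv hlt (m y) y
  refine ⟨μ₀, ?_⟩
  have hw : s * v / (s - v) ≠ 0 := by
    have : 0 < s - v := tsub_pos_of_lt hlt
    have : 0 < s := hv.trans hlt
    positivity
  have hinv : P = (gaussianReal (m y) v).withDensity (fun x => (gaussianPDF x s y / p y)⁻¹) := by
    rw [← hy, withDensity_inv_same₀ (by fun_prop)]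
    · exact ae_of_all _ fun x => ENNReal.div_ne_zero.2 ⟨(gaussianPDF_pos x hs y).ne', hptop y⟩
    · exact ae_of_all _ fun x => ENNReal.div_ne_top gaussianPDF_ne_top (hp0 y)
  have hfin : P = (ENNReal.ofReal K * p y) • gaussianReal μ₀ (s * v / (s - v)) := by
    conv_lhs => rw [hinv]
    rw [gaussianReal_of_var_ne_zero _ hv.ne', gaussianReal_of_var_ne_zero _ hw,
      ← withDensity_mul _ (measurable_gaussianPDF _ _) (by fun_prop),
      ← withDensity_smul _ (measurable_gaussianPDF _ _)]
    congr 1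
    funext x
    simp only [Pi.mul_apply, Pi.smul_apply, smul_eq_mul]
    have hx0 := (gaussianPDF_pos x hs y).ne'
    have e : gaussianPDF (m y) v x
        = ENNReal.ofReal K * gaussianPDF μ₀ (s * v / (s - v)) x * gaussianPDF x s y := by
      simp only [gaussianPDF]
      rw [hKx, ENNReal.ofReal_mul (mul_nonneg hK.le (gaussianPDFReal_nonneg _ _ _)),
        ENNReal.ofReal_mul hK.le]
    rw [e, ENNReal.inv_div (Or.inl (hptop y)) (Or.inl (hp0 y)), mul_assoc,
      ENNReal.mul_div_cancel hx0 gaussianPDF_ne_top]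
    ring
  have hc : ENNReal.ofReal K * p y = 1 := by
    have h := congrArg (fun ν : Measure ℝ => ν Set.univ) hfin
    simp only [Measure.smul_apply, measure_univ, smul_eq_mul, mul_one] at h
    exact h.symm
  rw [hfin, hc, one_smul]
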